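/- arXiv:2207.09997 — 6 statements merged into one kernel-verified Lean document; each statement's English description precedes it below -/
import Mathlib

section
/- Let λ ∈ ℝ, let r, m be integers with m, r ≥ 0, and let f ∈ ℝ[[x]] be a formal power series. Then (xD)_{m,λ}(x^r · f) = Σ_{l=0}^{m} {m+r \brace l+r}_{r,λ} · x^{l+r} · D^l f, where D^l f is the l-th formal derivative of f. -/
open Finset PowerSeries

/-- Degenerate falling factorial `(x)_{n,λ} = x(x-λ)⋯(x-(n-1)λ)`. -/
noncomputable def dfall (lam x : ℝ) (n : ℕ) : ℝ := ∏ i ∈ Finset.range n, (x - i * lam)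

/-- Ordinary falling factorial `(x)_n = x(x-1)⋯(x-n+1)`. -/
noncomputable def ffall (x : ℝ) (n : ℕ) : ℝ := ∏ i ∈ Finset.range n, (x - i)

/-- Degenerate rising factorial `⟨x⟩_{n,λ} = x(x+λ)⋯(x+(n-1)λ)`. -/
noncomputable def drise (lam x : ℝ) (n : ℕ) : ℝ := ∏ i ∈ Finset.range n, (x + i * lam)

/-- Rising factorial `⟨x⟩_n = x(x+1)⋯(x+n-1)`. -/
noncomputable def rise (x : ℝ) (n : ℕ) : ℝ := ∏ i ∈ Finset.range n, (x + i)

/-- Formal derivative `D = d/dx` on `ℝ⟦X⟧`. -/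
noncomputable def D (f : PowerSeries ℝ) : PowerSeries ℝ := PowerSeries.derivativeFun f

/-- The operator `(xD + c)_{m,λ} = (xD+c)(xD+c-λ)⋯(xD+c-(m-1)λ)` applied to a power series,
where the factor with the largest shift is applied first. -/
noncomputable def xDFall (lam c : ℝ) : ℕ → PowerSeries ℝ → PowerSeries ℝ
  | 0, f => f
  | m + 1, f => xDFall lam c m (PowerSeries.X * D f + (c - m * lam) • f)

lemma ffall_succ (x : ℝ) (n : ℕ) : ffall x (n + 1) = ffall x n * (x - n) :=
  Finset.prod_range_succ _ _

lemma ffall_natCast_eq_zero {j l : ℕ} (h : j < l) : ffall (j : ℝ) l = 0 :=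
  Finset.prod_eq_zero (Finset.mem_range.mpr h) (sub_self _)

lemma coeff_D (f : PowerSeries ℝ) (n : ℕ) :
    coeff n (D f) = coeff (n + 1) f * (n + 1) :=
  coeff_derivativeFun f n

lemma coeff_X_mul_D (f : PowerSeries ℝ) (n : ℕ) :
    coeff n (PowerSeries.X * D f) = n * coeff n f := by
  cases n with
  | zero => simp
  | succ n => rw [coeff_succ_X_mul, coeff_D, mul_comm]; push_cast; rfl

lemma coeff_D_iterate (f : PowerSeries ℝ) (l j : ℕ) :
    coeff j (D^[l] f) = ffall ((j + l : ℕ) : ℝ) l * coeff (j + l) f := by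
  induction l generalizing j with
  | zero => simp [ffall]
  | succ l ih =>
    rw [Function.iterate_succ_apply', coeff_D, ih, ffall_succ,
      show j + 1 + l = j + (l + 1) by ring]
    push_cast
    ring

/-- `x^l D^l` acts diagonally on monomials, with eigenvalues `(j)_l`. -/
lemma coeff_X_pow_mul_D_iterate (f : PowerSeries ℝ) (l j : ℕ) :
    coeff j (PowerSeries.X ^ l * D^[l] f) = ffall (j : ℝ) l * coeff j f := by
  rw [coeff_X_pow_mul']
  split_ifs with h
  · rw [coeff_D_iterate, Nat.sub_add_cancel h]
  · rw [ffall_natCast_eq_zero (not_le.mp h), zero_mul]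

/-- `(xD + c)_{m,λ}` acts diagonally on monomials, with eigenvalues `(n + c)_{m,λ}`. -/
lemma coeff_xDFall (lam c : ℝ) (m : ℕ) (g : PowerSeries ℝ) (n : ℕ) :
    coeff n (xDFall lam c m g) = dfall lam (n + c) m * coeff n g := by
  induction m generalizing g with
  | zero => simp [xDFall, dfall]
  | succ m ih =>
    rw [xDFall, ih, map_add, coeff_X_mul_D, coeff_smul, dfall, dfall, Finset.prod_range_succ]
    ring

/-- `(xD)_{m,λ}(x^r · f) = Σ_{l=0}^{m} {m+r \brace l+r}_{r,λ} x^{l+r} D^l f`. -/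
theorem statement0 (lam : ℝ) (r m : ℕ) (S : ℕ → ℤ → ℝ)
    (hS : ∀ (n : ℕ) (x : ℝ),
      dfall lam (x + r) n = ∑ k ∈ Finset.range (n + 1), S n k * ffall x k)
    (hS0 : ∀ (n : ℕ) (k : ℤ), k < 0 ∨ (n : ℤ) < k → S n k = 0)
    (f : PowerSeries ℝ) :
    xDFall lam 0 m (PowerSeries.X ^ r * f)
      = ∑ l ∈ Finset.range (m + 1), S m l • (PowerSeries.X ^ (l + r) * D^[l] f) := by
  ext n
  rw [coeff_xDFall, add_zero, map_sum]
  have hX : ∀ l, PowerSeries.X ^ (l + r) * D^[l] f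
      = PowerSeries.X ^ r * (PowerSeries.X ^ l * D^[l] f) := fun l => by ring
  simp only [hX, coeff_smul, coeff_X_pow_mul' _ r n, coeff_X_pow_mul_D_iterate]
  split_ifs with h
  · have hn : (n : ℝ) = ((n - r : ℕ) : ℝ) + r := by rw [← Nat.cast_add, Nat.sub_add_cancel h]
    rw [hn, hS, Finset.sum_mul]
    exact Finset.sum_congr rfl fun l _ => mul_assoc _ _ _
  · simp
end

section
/- Let A be an associative unital ℝ-algebra containing elements a and a⁺ with a·a⁺ − a⁺·a = 1, let λ ∈ ℝ, and let m, r be integers with m, r ≥ 0. Then (a⁺a)_{m,λ} (a⁺)^r = Σ_{l=0}^{m} {m+r \brace l+r}_{r,λ} · (a⁺)^{l+r} a^l in A. -/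
open Finset

/-- Degenerate falling factorial of an algebra element:
`(u)_{m,λ} = ∏_{i=0}^{m-1} (u - iλ·1)`, multiplied in increasing order of `i`. -/
noncomputable def algFall {A : Type*} [Ring A] [Algebra ℝ A] (lam : ℝ) (u : A) (m : ℕ) : A :=
  ((List.range m).map (fun i => u - ((i : ℝ) * lam) • (1 : A))).prod

section Weyl

open Polynomial

theorem semiconjBy_creation_pow {A : Type*} [Ring A] {a ad : A}
    (hcomm : a * ad - ad * a = 1) (r : ℕ) :
    SemiconjBy (ad ^ r) (ad * a + r) (ad * a) := by
  have hc : a * ad = ad * a + 1 := by rw [← hcomm]; abel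
  induction r with
  | zero => simp
  | succ r ih =>
    have h : SemiconjBy ad (ad * a + (r + 1 : ℕ)) (ad * a + r) := by
      have h₁ : SemiconjBy ad (ad * a + 1) (ad * a) := by
        rw [SemiconjBy, ← hc]; simp only [mul_assoc]
      have h₂ := h₁.add_right (Nat.cast_commute r ad).symm
      rwa [add_assoc, add_comm (1 : A), ← Nat.cast_succ] at h₂
    rw [pow_succ]
    exact ih.mul_left h

theorem semiconjBy_annihilation_pow {A : Type*} [Ring A] {a ad : A}
    (hcomm : a * ad - ad * a = 1) (l : ℕ) :
    SemiconjBy (a ^ l) (ad * a - l) (ad * a) := by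
  have hc : a * ad = ad * a + 1 := by rw [← hcomm]; abel
  induction l with
  | zero => simp
  | succ l ih =>
    have h : SemiconjBy a (ad * a - (l + 1 : ℕ)) (ad * a - l) := by
      have h₁ : SemiconjBy a (ad * a - 1) (ad * a) := by
        rw [SemiconjBy, mul_sub, ← mul_assoc, hc]; noncomm_ring
      have h₂ := h₁.sub_right (Nat.cast_commute l a).symm
      rwa [sub_sub, add_comm (1 : A), ← Nat.cast_succ] at h₂
    rw [pow_succ]
    exact ih.mul_left h

variable {A : Type*} [Ring A] [Algebra ℝ A]

/-- The polynomial `∏_{i<n} (X - iλ)`. -/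
noncomputable def dfallPoly (lam : ℝ) (n : ℕ) : ℝ[X] :=
  ∏ i ∈ Finset.range n, (X - C ((i : ℝ) * lam))

theorem eval_dfallPoly (lam x : ℝ) (n : ℕ) : (dfallPoly lam n).eval x = dfall lam x n := by
  simp [dfallPoly, dfall, eval_prod]

theorem dfall_one (x : ℝ) (n : ℕ) : dfall 1 x n = ffall x n := by
  simp [dfall, ffall]

theorem dfallPoly_succ (lam : ℝ) (n : ℕ) :
    dfallPoly lam (n + 1) = dfallPoly lam n * (X - C ((n : ℝ) * lam)) :=
  Finset.prod_range_succ _ _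

theorem algFall_succ (lam : ℝ) (u : A) (n : ℕ) :
    algFall lam u (n + 1) = algFall lam u n * (u - ((n : ℝ) * lam) • (1 : A)) := by
  simp [algFall, List.range_succ]

theorem aeval_dfallPoly (lam : ℝ) (u : A) (n : ℕ) :
    aeval u (dfallPoly lam n) = algFall lam u n := by
  induction n with
  | zero => simp [dfallPoly, algFall]
  | succ n ih =>
    rw [dfallPoly_succ, map_mul, ih, algFall_succ, map_sub, aeval_X, aeval_C,
      Algebra.algebraMap_eq_smul_one]

theorem SemiconjBy.aeval {c x y : A} (h : SemiconjBy c x y) (p : ℝ[X]) :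
    SemiconjBy c (Polynomial.aeval x p) (Polynomial.aeval y p) := by
  induction p using Polynomial.induction_on' with
  | add p q hp hq => simpa using hp.add_right hq
  | monomial n b =>
    rw [aeval_monomial, aeval_monomial]
    exact SemiconjBy.mul_right (Algebra.commutes b c).symm (h.pow_right n)

theorem aeval_dfallPoly_one {a ad : A}
    (hcomm : a * ad - ad * a = 1) (l : ℕ) :
    aeval (ad * a) (dfallPoly 1 l) = ad ^ l * a ^ l := by
  induction l with
  | zero => simp [dfallPoly]
  | succ l ih =>
    have h := (semiconjBy_annihilation_pow hcomm l).eq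
    rw [dfallPoly_succ, map_mul, ih]
    simp only [mul_one, map_sub, aeval_X, map_natCast]
    rw [mul_assoc, h, pow_succ, pow_succ']
    simp only [mul_assoc]

end Weyl

/-- `(a⁺a)_{m,λ}(a⁺)^r = Σ_{l=0}^{m} {m+r \brace l+r}_{r,λ} (a⁺)^{l+r} a^l`. -/
theorem statement2 {A : Type*} [Ring A] [Algebra ℝ A] (a ad : A)
    (hcomm : a * ad - ad * a = 1) (lam : ℝ) (m r : ℕ) (S : ℕ → ℤ → ℝ)
    (hS : ∀ (n : ℕ) (x : ℝ),
      dfall lam (x + r) n = ∑ k ∈ Finset.range (n + 1), S n k * ffall x k)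
    (hS0 : ∀ (n : ℕ) (k : ℤ), k < 0 ∨ (n : ℤ) < k → S n k = 0) :
    algFall lam (ad * a) m * ad ^ r
      = ∑ l ∈ Finset.range (m + 1), S m l • (ad ^ (l + r) * a ^ l) := by
  have hpoly : (dfallPoly lam m).comp (Polynomial.X + Polynomial.C (r : ℝ))
      = ∑ l ∈ Finset.range (m + 1), S m l • dfallPoly 1 l := by
    refine Polynomial.funext fun x => ?_
    simp [Polynomial.eval_finsetSum, eval_dfallPoly, dfall_one, hS]
  have haeval := congrArg (Polynomial.aeval (ad * a)) hpoly
  simp only [Polynomial.aeval_comp, map_add, Polynomial.aeval_X, map_natCast,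
    map_sum, map_smul, aeval_dfallPoly_one hcomm] at haeval
  rw [← aeval_dfallPoly, ← ((semiconjBy_creation_pow hcomm r).aeval _).eq, haeval,
    Finset.mul_sum]
  refine Finset.sum_congr rfl fun l _ => ?_
  rw [mul_smul_comm, ← mul_assoc, ← pow_add, add_comm r l]
end

section
/- Let A be an associative unital ℝ-algebra containing elements a and a⁺ with a·a⁺ − a⁺·a = 1, let λ ∈ ℝ, and let k, r be integers with k, r ≥ 0. Then (a⁺)^k a^k = Σ_{m=0}^{k} (−1)^{k−m} {k+r \brack m+r}_{r,λ} · (a⁺a + r)_{m,λ} in A. -/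
open Finset

open Polynomial in
lemma algFall_eq_aeval {A : Type*} [Ring A] [Algebra ℝ A] (lam : ℝ) (u : A) (m : ℕ) :
    algFall lam u m = aeval u (∏ i ∈ Finset.range m, (X - C ((i : ℝ) * lam))) := by
  induction m with
  | zero => simp [algFall]
  | succ m ih =>
    rw [Finset.prod_range_succ, map_mul, ← ih]
    have hm : lam • (m : A) = ((m : ℝ) * lam) • (1 : A) := by
      rw [mul_comm, mul_smul, Nat.cast_smul_eq_nsmul, nsmul_one]
    simp [algFall, List.range_succ, Algebra.algebraMap_eq_smul_one, hm]

lemma mul_mul_pow_of_commutator_eq_one {A : Type*} [Ring A] {a b : A}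
    (h : a * b - b * a = 1) (k : ℕ) : b * a * a ^ k = a ^ k * (b * a - k) := by
  have hab : b * a = a * b - 1 := by rw [← h]; abel
  induction k with
  | zero => simp
  | succ k ih =>
    calc b * a * a ^ (k + 1) = b * a * a ^ k * a := by rw [pow_succ, mul_assoc _ _ a]
      _ = a ^ k * ((b * a - k) * a) := by rw [ih, mul_assoc]
      _ = a ^ k * (a * (b * a - (k + 1 : ℕ))) := by
        congr 1
        rw [sub_mul, (Nat.cast_commute k a).eq]
        nth_rw 1 [hab]
        push_cast
        noncomm_ring
      _ = a ^ (k + 1) * (b * a - (k + 1 : ℕ)) := by rw [pow_succ, mul_assoc]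

open Polynomial in
lemma pow_mul_pow_eq_aeval {A : Type*} [Ring A] [Algebra ℝ A] {a b : A}
    (h : a * b - b * a = 1) (k : ℕ) :
    b ^ k * a ^ k = aeval (b * a) (∏ i ∈ Finset.range k, (X - C (i : ℝ))) := by
  induction k with
  | zero => simp
  | succ k ih =>
    rw [Finset.prod_range_succ, map_mul, ← ih, pow_succ b, pow_succ' a,
      mul_assoc, ← mul_assoc b, mul_mul_pow_of_commutator_eq_one h, ← mul_assoc]
    simp

lemma rise_neg (y : ℝ) (n : ℕ) :
    rise (-y) n = (-1) ^ n * ∏ i ∈ Finset.range n, (y - i) := by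
  rw [rise, ← Finset.card_range n, ← Finset.prod_const, Finset.card_range,
    ← Finset.prod_mul_distrib]
  exact Finset.prod_congr rfl fun i _ => by ring

lemma drise_neg (lam y : ℝ) (n : ℕ) :
    drise lam (-y) n = (-1) ^ n * dfall lam y n := by
  rw [drise, dfall, ← Finset.card_range n, ← Finset.prod_const, Finset.card_range,
    ← Finset.prod_mul_distrib]
  exact Finset.prod_congr rfl fun i _ => by ring

open Polynomial in
lemma prod_X_sub_natCast_comp_eq_sum (lam : ℝ) (k r : ℕ) (c : ℕ → ℝ)
    (hc : ∀ x : ℝ, rise (x + r) k = ∑ j ∈ Finset.range (k + 1), c j * drise lam x j) :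
    (∏ i ∈ Finset.range k, (X - C (i : ℝ))).comp (X - C (r : ℝ))
      = ∑ m ∈ Finset.range (k + 1), ((-1 : ℝ) ^ (k - m) * c m) •
          ∏ i ∈ Finset.range m, (X - C ((i : ℝ) * lam)) := by
  refine Polynomial.funext fun y => ?_
  have h := hc (-y)
  rw [show -y + (r : ℝ) = -(y - r) by ring, rise_neg] at h
  have hk : ((-1 : ℝ) ^ k) * (-1) ^ k = 1 := by rw [← mul_pow]; simp
  simp only [eval_comp, eval_prod, eval_finsetSum, eval_smul, eval_sub, eval_X, eval_C, smul_eq_mul]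
  have h' : ∏ i ∈ Finset.range k, (y - r - (i : ℝ))
      = (-1) ^ k * ∑ j ∈ Finset.range (k + 1), c j * drise lam (-y) j := by
    rw [← h, ← mul_assoc, hk, one_mul]
  rw [h', Finset.mul_sum]
  refine Finset.sum_congr rfl fun m hm => ?_
  obtain ⟨d, rfl⟩ := Nat.exists_eq_add_of_le (Nat.lt_succ_iff.mp (Finset.mem_range.mp hm))
  have hm1 : ((-1 : ℝ) ^ m) * (-1) ^ m = 1 := by rw [← mul_pow]; simp
  rw [drise_neg, dfall, Nat.add_sub_cancel_left, pow_add]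
  linear_combination
    (-1) ^ d * c m * (∏ i ∈ Finset.range m, (y - (i : ℝ) * lam)) * hm1

/-- `(a⁺)^k a^k = Σ_{m=0}^{k} (−1)^{k−m} {k+r \brack m+r}_{r,λ} (a⁺a+r)_{m,λ}`. -/
theorem statement6 {A : Type*} [Ring A] [Algebra ℝ A] (a ad : A)
    (hcomm : a * ad - ad * a = 1) (lam : ℝ) (k r : ℕ) (T : ℕ → ℤ → ℝ)
    (hT : ∀ (n : ℕ) (x : ℝ),
      rise (x + r) n = ∑ j ∈ Finset.range (n + 1), T n j * drise lam x j)
    (hT0 : ∀ (n : ℕ) (j : ℤ), j < 0 ∨ (n : ℤ) < j → T n j = 0) :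
    ad ^ k * a ^ k
      = ∑ m ∈ Finset.range (k + 1),
          ((-1 : ℝ) ^ (k - m) * T k m) • algFall lam (ad * a + (r : A)) m := by
  rw [pow_mul_pow_eq_aeval hcomm]
  have h := congrArg (Polynomial.aeval (ad * a + (r : A)))
    (prod_X_sub_natCast_comp_eq_sum lam k r (fun j => T k j) (hT k))
  rw [Polynomial.aeval_comp] at h
  simpa [algFall_eq_aeval] using h
end

section
/- Let A be an associative unital ℝ-algebra containing elements a and a⁺ with a·a⁺ − a⁺·a = 1, let λ ∈ ℝ, and let n, r be integers with n, r ≥ 0. Then (a⁺)^r (a⁺a + r)_{n,λ} = (a⁺a)_{n,λ} (a⁺)^r in A. -/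
open Finset

/-- An element that intertwines `u` and `v` intertwines their degenerate falling factorials. -/
theorem SemiconjBy.algFall {A : Type*} [Ring A] [Algebra ℝ A] {x u v : A}
    (h : SemiconjBy x u v) (lam : ℝ) (n : ℕ) :
    SemiconjBy x (algFall lam u n) (algFall lam v n) := by
  induction n with
  | zero => simp [_root_.algFall]
  | succ n ih =>
    simp only [_root_.algFall, List.range_succ, List.bind_eq_flatMap, List.flatMap_append,
      List.map_append, List.prod_append] at ih ⊢
    refine ih.mul_right ?_
    simpa using h.sub_right ((SemiconjBy.one_right x).smul_right ((n : ℝ) * lam))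

/-- The creation operator raised to the power `r` shifts the number operator by `r`. -/
theorem semiconjBy_pow_number_add {A : Type*} [Ring A] {a ad : A}
    (hcomm : a * ad - ad * a = 1) (r : ℕ) :
    SemiconjBy (ad ^ r) (ad * a + (r : A)) (ad * a) := by
  induction r with
  | zero => simp
  | succ r ih =>
    have hone : SemiconjBy ad (ad * a + 1) (ad * a) := by
      rw [SemiconjBy, mul_assoc ad a ad, ← sub_eq_iff_eq_add'.mp hcomm]
    have hr : SemiconjBy ad (ad * a + 1 + (r : A)) (ad * a + (r : A)) :=
      hone.add_right (Nat.cast_commute r ad).symm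
    rw [pow_succ, Nat.cast_succ, add_comm (r : A), ← add_assoc]
    exact ih.mul_left hr

/-- `(a⁺)^r (a⁺a+r)_{n,λ} = (a⁺a)_{n,λ} (a⁺)^r`. -/
theorem statement9 {A : Type*} [Ring A] [Algebra ℝ A] (a ad : A)
    (hcomm : a * ad - ad * a = 1) (lam : ℝ) (n r : ℕ) :
    ad ^ r * algFall lam (ad * a + (r : A)) n = algFall lam (ad * a) n * ad ^ r :=
  ((semiconjBy_pow_number_add hcomm r).algFall lam n).eq
end

section
/- Let A be an associative unital ℝ-algebra containing elements a and a⁺ with a·a⁺ − a⁺·a = 1, let λ ∈ ℝ, and let n, r be integers with n, r ≥ 0. Then (a⁺a + r)_{n,λ} = Σ_{k=0}^{n} {n+r \brace k+r}_{r,λ} · (a⁺)^k a^k in A. -/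
open Finset

open Polynomial in
lemma aeval_prod_X_sub_C {A : Type*} [Ring A] [Algebra ℝ A] (u : A) (c : ℕ → ℝ) (n : ℕ) :
    aeval u (∏ i ∈ Finset.range n, (X - C (c i)))
      = ((List.range n).map fun i => u - c i • (1 : A)).prod := by
  induction n with
  | zero => simp
  | succ n ih =>
    simp [Finset.prod_range_succ, List.range_succ, ih, Algebra.algebraMap_eq_smul_one]

lemma algFall_eq_prod_map {A : Type*} [Ring A] [Algebra ℝ A] (lam : ℝ) (u : A) (n : ℕ) :
    algFall lam u n = ((List.range n).map fun i : ℕ => u - ((i : ℝ) * lam) • (1 : A)).prod := by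
  simp [algFall, List.map_flatMap, List.map_eq_flatMap (l := List.range n)]

lemma pow_mul_number {A : Type*} [Ring A] {a ad : A} (hcomm : a * ad - ad * a = 1) (k : ℕ) :
    a ^ k * (ad * a) = ad * a ^ (k + 1) + k * a ^ k := by
  induction k with
  | zero => simp
  | succ k ih =>
    have h : a * ad = ad * a + 1 := by rw [← hcomm]; abel
    calc a ^ (k + 1) * (ad * a) = a * (a ^ k * (ad * a)) := by rw [pow_succ', mul_assoc]
      _ = a * ad * a ^ (k + 1) + k * a ^ (k + 1) := by
        rw [ih, mul_add, ← mul_assoc, ← mul_assoc, ← Nat.cast_comm, mul_assoc (k : A), ← pow_succ']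
      _ = ad * a ^ (k + 1 + 1) + (k + 1 : ℕ) * a ^ (k + 1) := by
        rw [h, pow_succ' a (k + 1), Nat.cast_add, Nat.cast_one]
        noncomm_ring

open Polynomial in
/-- Normal ordering of the falling factorial of the number operator. -/
lemma aeval_number_prod_X_sub {A : Type*} [Ring A] [Algebra ℝ A] {a ad : A}
    (hcomm : a * ad - ad * a = 1) (k : ℕ) :
    aeval (ad * a) (∏ i ∈ Finset.range k, (X - C (i : ℝ))) = ad ^ k * a ^ k := by
  induction k with
  | zero => simp
  | succ k ih =>
    rw [Finset.prod_range_succ, map_mul, ih, map_sub, aeval_X, aeval_C, map_natCast, mul_assoc,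
      mul_sub, pow_mul_number hcomm, ← Nat.cast_comm, add_sub_cancel_right, ← mul_assoc,
      ← pow_succ]

/-- `(a⁺a+r)_{n,λ} = Σ_{k=0}^{n} {n+r \brace k+r}_{r,λ} (a⁺)^k a^k`. -/
theorem statement10 {A : Type*} [Ring A] [Algebra ℝ A] (a ad : A)
    (hcomm : a * ad - ad * a = 1) (lam : ℝ) (n r : ℕ) (S : ℕ → ℤ → ℝ)
    (hS : ∀ (m : ℕ) (x : ℝ),
      dfall lam (x + r) m = ∑ k ∈ Finset.range (m + 1), S m k * ffall x k)
    (hS0 : ∀ (m : ℕ) (k : ℤ), k < 0 ∨ (m : ℤ) < k → S m k = 0) :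
    algFall lam (ad * a + (r : A)) n
      = ∑ k ∈ Finset.range (n + 1), S n k • (ad ^ k * a ^ k) := by
  open Polynomial in
  have hP : (∏ i ∈ Finset.range n, (X - C ((i : ℝ) * lam))).comp (X + C (r : ℝ))
      = ∑ k ∈ Finset.range (n + 1), C (S n k) * ∏ i ∈ Finset.range k, (X - C (i : ℝ)) := by
    refine Polynomial.funext fun x => ?_
    simpa [dfall, ffall, eval_prod, eval_finsetSum] using hS n x
  have h := congrArg (Polynomial.aeval (ad * a)) hP
  rw [Polynomial.aeval_comp, aeval_prod_X_sub_C, map_sum] at h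
  simp only [map_mul, Polynomial.aeval_C, aeval_number_prod_X_sub hcomm, ← Algebra.smul_def] at h
  simpa [algFall_eq_prod_map] using h
end

section
/- Let λ ∈ ℝ and let r ≥ 0 be an integer. For all integers k, m with k ≥ m ≥ 0, the unsigned degenerate r-Stirling numbers of the first kind satisfy (−1)^{k−m+1} {(k+1)+r \brack m+r}_{r,λ} = Σ_{l=m−1}^{k} {k+r \brack l+r}_{r,λ} (−1)^{k−m+1} C(l, m−1) ⟨1⟩_{l−m+1,λ} + (mλ − r) · Σ_{l=m}^{k} {k+r \brack l+r}_{r,λ} (−1)^{k−m} C(l, m) ⟨1⟩_{l−m,λ}, where C(·,·) is the binomial coefficient, ⟨1⟩_{j,λ} = 1·(1+λ)·(1+2λ)⋯(1+(j−1)λ) (with ⟨1⟩_{0,λ} = 1), and for m = 0 the first sum is interpreted via the conventions that the l = −1 term is absent and C(l, −1) = 0 for l ≥ 0 (so the whole first sum vanishes when m = 0). -/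
open Finset

theorem drise_succ (lam x : ℝ) (n : ℕ) :
    drise lam x (n + 1) = drise lam x n * (x + n * lam) :=
  Finset.prod_range_succ _ _

theorem drise_succ' (lam x : ℝ) (n : ℕ) :
    drise lam x (n + 1) = x * drise lam (x + lam) n := by
  unfold drise
  rw [Finset.prod_range_succ', mul_comm]
  congr 1
  · simp
  · refine Finset.prod_congr rfl fun i _ => ?_
    push_cast
    ring

theorem continuous_drise (lam : ℝ) (n : ℕ) : Continuous fun x => drise lam x n := by
  unfold drise
  fun_prop

/-- The Vandermonde identity for degenerate rising factorials. -/
theorem drise_add (lam x y : ℝ) (n : ℕ) :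
    drise lam (x + y) n
      = ∑ j ∈ Finset.range (n + 1), (n.choose j : ℝ) * (drise lam x j * drise lam y (n - j)) := by
  rw [← Finset.Nat.sum_antidiagonal_eq_sum_range_succ
    (fun i j => (n.choose i : ℝ) * (drise lam x i * drise lam y j))]
  induction n with
  | zero => simp [drise]
  | succ n ih =>
    rw [Finset.sum_antidiagonal_choose_succ_mul (fun i j => drise lam x i * drise lam y j),
      drise_succ, ih, Finset.sum_mul, ← Finset.sum_add_distrib]
    refine Finset.sum_congr rfl fun p hp => ?_
    have hp' : p.1 + p.2 = n := Finset.HasAntidiagonal.mem_antidiagonal.mp hp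
    have hc : n.choose p.2 = n.choose p.1 := by
      rw [← hp', Nat.choose_symm_add]
    rw [hc, drise_succ, drise_succ, ← hp']
    push_cast
    ring

/-- Degenerate rising factorials are linearly independent. -/
theorem eq_zero_of_sum_mul_drise_eq_zero (lam : ℝ) (n : ℕ) (a : ℕ → ℝ)
    (h : ∀ x, ∑ j ∈ Finset.range n, a j * drise lam x j = 0) (j : ℕ) (hj : j < n) :
    a j = 0 := by
  induction n generalizing a j with
  | zero => omega
  | succ n ih =>
    have h0 : a 0 = 0 := by
      have := h 0
      rw [Finset.sum_range_succ'] at this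
      simp only [drise_succ', zero_mul, mul_zero, Finset.sum_const_zero, zero_add] at this
      simpa [drise] using this
    have hx (x : ℝ) : x * ∑ i ∈ Finset.range n, a (i + 1) * drise lam (x + lam) i = 0 := by
      rw [← h x, Finset.sum_range_succ', h0, Finset.mul_sum]
      simp only [zero_mul, add_zero, drise_succ']
      exact Finset.sum_congr rfl fun i _ => by ring
    have hcont : Continuous fun x =>
        ∑ i ∈ Finset.range n, a (i + 1) * drise lam (x + lam) i :=
      continuous_finsetSum _ fun i _ =>
        continuous_const.mul ((continuous_drise lam i).comp (continuous_id.add continuous_const))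
    have hzero := hcont.ext_on (dense_compl_singleton (0 : ℝ)) continuous_const
      fun x hx0 => (mul_eq_zero.mp (hx x)).resolve_left hx0
    cases j with
    | zero => exact h0
    | succ j =>
      refine ih (fun i => a (i + 1)) (fun x => ?_) j (by omega)
      simpa using congrFun hzero (x - lam)

/-- Coefficients of the shift by one of an expansion in degenerate rising factorials. -/
theorem sum_mul_drise_add_one (lam x : ℝ) (k : ℕ) (a : ℕ → ℝ) :
    ∑ l ∈ Finset.range (k + 1), a l * drise lam (x + 1) l
      = ∑ j ∈ Finset.range (k + 1),
          (∑ l ∈ Finset.Icc j k, a l * (l.choose j : ℝ) * drise lam 1 (l - j))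
            * drise lam x j := by
  simp_rw [drise_add, Finset.mul_sum, Finset.sum_mul]
  rw [Finset.sum_comm' (t' := Finset.range (k + 1)) (s' := fun j => Finset.Icc j k)]
  · exact Finset.sum_congr rfl fun j _ => Finset.sum_congr rfl fun l _ => by ring
  · intro l j
    simp only [Finset.mem_range, Finset.mem_Icc]
    omega

theorem add_mul_sum_mul_drise (lam x r : ℝ) (k : ℕ) (c : ℕ → ℝ) (hc : c (k + 1) = 0) :
    (x + r) * ∑ j ∈ Finset.range (k + 1), c j * drise lam x j
      = ∑ j ∈ Finset.range (k + 2),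
          ((if j = 0 then 0 else c (j - 1)) + (r - j * lam) * c j) * drise lam x j := by
  simp_rw [add_mul _ _ (drise lam x _)]
  rw [Finset.sum_add_distrib,
    Finset.sum_range_succ' (fun j => (if j = 0 then 0 else c (j - 1)) * drise lam x j),
    Finset.sum_range_succ _ (k + 1), hc, Finset.mul_sum]
  simp only [Nat.add_eq_zero_iff, one_ne_zero, and_false, if_false, Nat.add_sub_cancel, if_true,
    zero_mul, mul_zero, add_zero]
  rw [← Finset.sum_add_distrib]
  refine Finset.sum_congr rfl fun j _ => ?_
  rw [drise_succ]
  ring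

theorem rise_succ' (x : ℝ) (n : ℕ) : rise x (n + 1) = x * rise (x + 1) n := by
  simpa [rise, drise] using drise_succ' 1 x n

/-- the recurrence
`(−1)^{k−m+1}{k+1+r \brack m+r}_{r,λ}
 = Σ_{l=m−1}^{k} {k+r \brack l+r}_{r,λ}(−1)^{k−m+1}C(l,m−1)⟨1⟩_{l−m+1,λ}
 + (mλ−r) Σ_{l=m}^{k} {k+r \brack l+r}_{r,λ}(−1)^{k−m}C(l,m)⟨1⟩_{l−m,λ}` for `k ≥ m ≥ 0`,
where the first sum vanishes when `m = 0` by the convention `C(l,−1) = 0`. -/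
theorem statement14 (lam : ℝ) (r : ℕ) (T : ℕ → ℤ → ℝ)
    (hT : ∀ (n : ℕ) (x : ℝ),
      rise (x + r) n = ∑ j ∈ Finset.range (n + 1), T n j * drise lam x j)
    (hT0 : ∀ (n : ℕ) (j : ℤ), j < 0 ∨ (n : ℤ) < j → T n j = 0)
    (k m : ℕ) (hmk : m ≤ k) :
    (-1 : ℝ) ^ (k + 1 - m) * T (k + 1) m
      = (∑ l ∈ Finset.Icc (m - 1) k,
          T k l * (-1 : ℝ) ^ (k + 1 - m)
            * (if m = 0 then 0 else (l.choose (m - 1) : ℝ)) * drise lam 1 (l + 1 - m))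
        + ((m : ℝ) * lam - r) * ∑ l ∈ Finset.Icc m k,
            T k l * (-1 : ℝ) ^ (k - m) * (l.choose m : ℝ) * drise lam 1 (l - m) := by
  set c : ℕ → ℝ := fun j =>
    ∑ l ∈ Finset.Icc j k, T k l * (l.choose j : ℝ) * drise lam 1 (l - j) with hc
  have key : T (k + 1) m = (if m = 0 then 0 else c (m - 1)) + ((r : ℝ) - m * lam) * c m := by
    refine sub_eq_zero.mp (eq_zero_of_sum_mul_drise_eq_zero lam (k + 2)
      (fun j => T (k + 1) j - ((if j = 0 then 0 else c (j - 1)) + ((r : ℝ) - j * lam) * c j))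
      (fun x => ?_) m (by omega))
    simp_rw [sub_mul _ _ (drise lam x _)]
    rw [Finset.sum_sub_distrib, ← hT (k + 1) x, rise_succ', add_right_comm, hT k (x + 1),
      sum_mul_drise_add_one lam x k (fun l => T k l),
      ← add_mul_sum_mul_drise lam x r k c (by simp [hc]), sub_self]
  have hfirst : (∑ l ∈ Finset.Icc (m - 1) k, T k l * (-1 : ℝ) ^ (k + 1 - m)
      * (if m = 0 then 0 else (l.choose (m - 1) : ℝ)) * drise lam 1 (l + 1 - m))
      = (-1 : ℝ) ^ (k + 1 - m) * (if m = 0 then 0 else c (m - 1)) := by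
    cases m with
    | zero => simp
    | succ m =>
      simp only [Nat.add_eq_zero_iff, one_ne_zero, and_false, if_false, Nat.add_sub_cancel,
        Nat.add_sub_add_right, hc, Finset.mul_sum]
      exact Finset.sum_congr rfl fun l _ => by ring
  have hsecond : (∑ l ∈ Finset.Icc m k,
      T k l * (-1 : ℝ) ^ (k - m) * (l.choose m : ℝ) * drise lam 1 (l - m))
      = (-1 : ℝ) ^ (k - m) * c m := by
    rw [hc, Finset.mul_sum]
    exact Finset.sum_congr rfl fun l _ => by ring
  rw [hfirst, hsecond, key, Nat.succ_sub hmk, pow_succ]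
  ring
end
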